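/- arXiv:1805.06720 — 2 statements merged into one kernel-verified Lean document; each statement's English description precedes it below -/
import Mathlib

section
/- Let μ be σ-finite, non-atomic with μ(Ω) = ∞, let p be a strictly monotone lattice norm on ℝ² with p((1,0)) = p((0,1)) = 1, and let Φ be an Orlicz function with a(Φ) = 0 satisfying condition Δ₂(ℝ₊). Then (L^Φ(μ), ‖·‖_{Φ,p}) is uniformly monotone: for every ε ∈ (0,1) there exists δ(ε) ∈ (0,1) such that for all x, y ∈ L^Φ(μ) with 0 ≤ x ≤ y μ-a.e., ‖y‖_{Φ,p} = 1 and ‖x‖_{Φ,p} ≥ ε, one has ‖y − x‖_{Φ,p} ≤ 1 − δ(ε). -/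
open MeasureTheory Filter

noncomputable section

/-- The Orlicz modular `I_Φ(x) = ∫ Φ(x t) dμ` (valued in `[0,∞]`). -/
def Iphi {Ω : Type*} [MeasurableSpace Ω] (μ : Measure Ω) (Φ : ℝ → ℝ) (x : Ω → ℝ) : ENNReal :=
  ∫⁻ t, ENNReal.ofReal (Φ (x t)) ∂μ

/-- One term `(1/k)·p((1, I_Φ(kx)))` of the defining infimum; value `∞` if `I_Φ(kx) = ∞`. -/
def aTerm {Ω : Type*} [MeasurableSpace Ω] (μ : Measure Ω) (Φ : ℝ → ℝ) (p : ℝ × ℝ → ℝ)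
    (x : Ω → ℝ) (k : ℝ) : ENNReal :=
  if Iphi μ Φ (fun t => k * x t) = ⊤ then ⊤
  else ENNReal.ofReal ((1 / k) * p (1, (Iphi μ Φ (fun t => k * x t)).toReal))

/-- The norm `‖x‖_{Φ,p} = inf_{k>0} (1/k)·p((1, I_Φ(kx)))`. -/
def aNorm {Ω : Type*} [MeasurableSpace Ω] (μ : Measure Ω) (Φ : ℝ → ℝ) (p : ℝ × ℝ → ℝ)
    (x : Ω → ℝ) : ENNReal :=
  ⨅ (k : ℝ) (_ : 0 < k), aTerm μ Φ p x k

/-- `Φ` is an Orlicz function: convex, even, vanishing at `0`, nonnegative, not identically `0`. -/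
def IsOrlicz (Φ : ℝ → ℝ) : Prop :=
  ConvexOn ℝ Set.univ Φ ∧ (∀ u, Φ (-u) = Φ u) ∧ Φ 0 = 0 ∧ (∀ u, 0 ≤ Φ u) ∧ ∃ u, Φ u ≠ 0

/-- `p` is a lattice norm on `ℝ²`: a norm which is monotone with respect to the
coordinatewise order on absolute values. -/
def IsLatticeNorm (p : ℝ × ℝ → ℝ) : Prop :=
  (∀ a b : ℝ × ℝ, p (a + b) ≤ p a + p b) ∧ (∀ (c : ℝ) (a : ℝ × ℝ), p (c • a) = |c| * p a) ∧
  (∀ a : ℝ × ℝ, p a = 0 → a = 0) ∧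
  (∀ a b : ℝ × ℝ, |a.1| ≤ |b.1| → |a.2| ≤ |b.2| → p a ≤ p b)

/-- `p` is strictly monotone: `0 ≤ a ≤ b` coordinatewise and `a ≠ b` imply `p a < p b`. -/
def StrictMonoNorm (p : ℝ × ℝ → ℝ) : Prop :=
  ∀ a b : ℝ × ℝ, 0 ≤ a.1 → 0 ≤ a.2 → a.1 ≤ b.1 → a.2 ≤ b.2 → a ≠ b → p a < p b

/-- Membership in the Orlicz space `L^Φ(μ)`. -/
def MemLphi {Ω : Type*} [MeasurableSpace Ω] (μ : Measure Ω) (Φ : ℝ → ℝ) (x : Ω → ℝ) : Prop :=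
  Measurable x ∧ ∃ l : ℝ, 0 < l ∧ Iphi μ Φ (fun t => l * x t) ≠ ⊤

/-- Membership in the space `E^Φ(μ)` of order continuous elements. -/
def MemEphi {Ω : Type*} [MeasurableSpace Ω] (μ : Measure Ω) (Φ : ℝ → ℝ) (x : Ω → ℝ) : Prop :=
  Measurable x ∧ ∀ l : ℝ, 0 < l → Iphi μ Φ (fun t => l * x t) ≠ ⊤

/-- `a(Φ) = sup{u ≥ 0 : Φ(u) = 0}`. -/
def aPhi (Φ : ℝ → ℝ) : ℝ := sSup {u : ℝ | 0 ≤ u ∧ Φ u = 0}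

/-- `K(x) = {k > 0 : ‖x‖_{Φ,p} = (1/k)·p((1, I_Φ(kx)))}`. -/
def Kset {Ω : Type*} [MeasurableSpace Ω] (μ : Measure Ω) (Φ : ℝ → ℝ) (p : ℝ × ℝ → ℝ)
    (x : Ω → ℝ) : Set ℝ :=
  {k : ℝ | 0 < k ∧ aNorm μ Φ p x = aTerm μ Φ p x k}

/-- Condition `Δ₂(ℝ₊)`: `Φ(2u) ≤ K·Φ(u)` for all `u ≥ 0`. -/
def Delta2 (Φ : ℝ → ℝ) : Prop := ∃ K : ℝ, 0 < K ∧ ∀ u : ℝ, 0 ≤ u → Φ (2 * u) ≤ K * Φ u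

/-- A non-atomic measure: every set of positive measure has a measurable subset of
strictly smaller positive measure. -/
def NonAtomic {Ω : Type*} [MeasurableSpace Ω] (μ : Measure Ω) : Prop :=
  ∀ A : Set Ω, MeasurableSet A → 0 < μ A →
    ∃ B ⊆ A, MeasurableSet B ∧ 0 < μ B ∧ μ B < μ A

/-- The modulus of monotonicity of `(ℝ², p)`:
`δ_{m,p}(ε) = inf{1 − p(b − a) : 0 ≤ a ≤ b coordinatewise, p a ≥ ε, p b = 1}`. -/
def deltaM (p : ℝ × ℝ → ℝ) (ε : ℝ) : ℝ :=
  sInf {d : ℝ | ∃ a b : ℝ × ℝ, 0 ≤ a.1 ∧ 0 ≤ a.2 ∧ a.1 ≤ b.1 ∧ a.2 ≤ b.2 ∧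
    ε ≤ p a ∧ p b = 1 ∧ d = 1 - p (b - a)}

theorem IsOrlicz.superadditive {Φ : ℝ → ℝ} (hΦ : IsOrlicz Φ) {a b : ℝ} (ha : 0 ≤ a)
    (hb : 0 ≤ b) : Φ a + Φ b ≤ Φ (a + b) := by
  obtain ⟨hconv, -, h0, -, -⟩ := hΦ
  rcases (add_nonneg ha hb).eq_or_lt with h | h
  · obtain rfl : a = 0 := by linarith
    obtain rfl : b = 0 := by linarith
    simp [h0]
  · have hs : b / (a + b) + a / (a + b) = 1 := by field_simp; ring
    have hs' : a / (a + b) + b / (a + b) = 1 := by field_simp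
    have h1 := hconv.2 (Set.mem_univ 0) (Set.mem_univ (a + b)) (by positivity) (by positivity) hs
    have h2 := hconv.2 (Set.mem_univ 0) (Set.mem_univ (a + b)) (by positivity) (by positivity) hs'
    simp only [smul_eq_mul, mul_zero, zero_add, h0, div_mul_cancel₀ _ h.ne'] at h1 h2
    calc Φ a + Φ b ≤ a / (a + b) * Φ (a + b) + b / (a + b) * Φ (a + b) := add_le_add h1 h2
      _ = Φ (a + b) := by rw [← add_mul, hs', one_mul]

theorem IsLatticeNorm.le_add {p : ℝ × ℝ → ℝ} (hp : IsLatticeNorm p) (h10 : p (1, 0) = 1)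
    (h01 : p (0, 1) = 1) (a : ℝ × ℝ) : p a ≤ |a.1| + |a.2| := by
  have h := hp.1 (a.1 • (1, 0)) (a.2 • (0, 1))
  rw [hp.2.1, hp.2.1, h10, h01, mul_one, mul_one] at h
  simpa using h

theorem IsLatticeNorm.continuous {p : ℝ × ℝ → ℝ} (hp : IsLatticeNorm p) (h10 : p (1, 0) = 1)
    (h01 : p (0, 1) = 1) : Continuous p := by
  have hle (a b : ℝ × ℝ) : p a ≤ p b + 2 * dist a b := by
    have h1 := hp.1 b (a - b)
    have h2 := hp.le_add h10 h01 (a - b)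
    have h3 := norm_fst_le (a - b)
    have h4 := norm_snd_le (a - b)
    rw [add_sub_cancel] at h1
    rw [dist_eq_norm]
    simp only [Real.norm_eq_abs] at h3 h4
    linarith
  exact (LipschitzWith.of_le_add_mul 2 fun a b => by simpa using hle a b).continuous

theorem IsLatticeNorm.exists_uniform_decrease {p : ℝ × ℝ → ℝ} (hp : IsLatticeNorm p)
    (hpm : StrictMonoNorm p) (h10 : p (1, 0) = 1) (h01 : p (0, 1) = 1) {c : ℝ} (hc : 0 < c) :
    ∃ d > 0, ∀ a b : ℝ, 0 ≤ a → a ≤ 2 → c ≤ b → b ≤ 2 → p (a, b - c) + d ≤ p (a, b) := by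
  have hcont := hp.continuous h10 h01
  have hne : (Set.Icc ((0 : ℝ), c) (2, c + 2)).Nonempty :=
    ⟨(0, c), le_rfl, Prod.mk_le_mk.2 ⟨by norm_num, by linarith⟩⟩
  obtain ⟨m, hm, hmin⟩ := isCompact_Icc.exists_isMinOn (s := Set.Icc ((0 : ℝ), c) (2, c + 2))
    (f := fun q : ℝ × ℝ => p q - p (q.1, q.2 - c)) hne (by fun_prop)
  refine ⟨p m - p (m.1, m.2 - c), ?_, fun a b ha ha2 hb hb2 => ?_⟩
  · have h1 := hm.1.1
    have h2 := hm.1.2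
    simp only at h1 h2
    refine sub_pos.2 (hpm _ _ h1 (by simpa using h2) le_rfl (by simpa using hc.le) fun h => ?_)
    have := congrArg Prod.snd h
    simp only at this
    linarith
  · have := hmin (show (a, b) ∈ Set.Icc ((0 : ℝ), c) (2, c + 2) from
      ⟨Prod.mk_le_mk.2 ⟨ha, hb⟩, Prod.mk_le_mk.2 ⟨ha2, by linarith⟩⟩)
    simp only [Set.mem_ofPred_eq] at this
    linarith

section Modular

variable {Ω : Type*} [MeasurableSpace Ω] {μ : Measure Ω} {Φ : ℝ → ℝ}

theorem Iphi_add_le (hΦ : IsOrlicz Φ) {u v : Ω → ℝ} (hu : ∀ᵐ t ∂μ, 0 ≤ u t)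
    (hv : ∀ᵐ t ∂μ, 0 ≤ v t) :
    Iphi μ Φ u + Iphi μ Φ v ≤ Iphi μ Φ (fun t => u t + v t) := by
  refine (le_lintegral_add _ _).trans (lintegral_mono_ae ?_)
  filter_upwards [hu, hv] with t hut hvt
  rw [← ENNReal.ofReal_add (hΦ.2.2.2.1 _) (hΦ.2.2.2.1 _)]
  exact ENNReal.ofReal_le_ofReal (hΦ.superadditive hut hvt)

theorem Iphi_two_pow_mul_le {K : ℝ} (hK : 0 < K) (hΔ : ∀ u : ℝ, 0 ≤ u → Φ (2 * u) ≤ K * Φ u)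
    {u : Ω → ℝ} (hu : ∀ᵐ t ∂μ, 0 ≤ u t) (n : ℕ) :
    Iphi μ Φ (fun t => 2 ^ n * u t) ≤ ENNReal.ofReal (K ^ n) * Iphi μ Φ u := by
  have hpow (n : ℕ) (s : ℝ) (hs : 0 ≤ s) : Φ (2 ^ n * s) ≤ K ^ n * Φ s := by
    induction n with
    | zero => simp
    | succ n ih =>
      calc Φ (2 ^ (n + 1) * s) = Φ (2 * (2 ^ n * s)) := by ring_nf
        _ ≤ K * Φ (2 ^ n * s) := hΔ _ (by positivity)
        _ ≤ K * (K ^ n * Φ s) := by gcongr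
        _ = K ^ (n + 1) * Φ s := by ring
  unfold Iphi
  rw [← lintegral_const_mul' _ _ ENNReal.ofReal_ne_top]
  refine lintegral_mono_ae ?_
  filter_upwards [hu] with t ht
  rw [← ENNReal.ofReal_mul (by positivity)]
  exact ENNReal.ofReal_le_ofReal (hpow n _ ht)

theorem le_of_ofReal_le_aNorm {p : ℝ × ℝ → ℝ} (hp : IsLatticeNorm p) (h10 : p (1, 0) = 1)
    (h01 : p (0, 1) = 1) {x : Ω → ℝ} {ε : ℝ} (hε : 0 < ε)
    (hx : ENNReal.ofReal ε ≤ aNorm μ Φ p x) {j : ℝ} (hj : 0 < j)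
    (hfin : Iphi μ Φ (fun t => j * x t) ≠ ⊤) :
    ε * j ≤ 1 + (Iphi μ Φ (fun t => j * x t)).toReal := by
  have h := hx.trans (iInf₂_le j hj)
  rw [aTerm, if_neg hfin] at h
  have h2 : ε ≤ 1 / j * p (1, (Iphi μ Φ (fun t => j * x t)).toReal) := by
    by_contra! hlt
    exact absurd h (not_le.2 ((ENNReal.ofReal_lt_ofReal_iff hε).2 hlt))
  have h3 := hp.le_add h10 h01 (1, (Iphi μ Φ (fun t => j * x t)).toReal)
  simp only [abs_one, abs_of_nonneg ENNReal.toReal_nonneg] at h3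
  rw [one_div_mul_eq_div, le_div_iff₀ hj] at h2
  exact h2.trans h3

end Modular

/-- If `μ` is σ-finite, non-atomic and infinite, `p` is a strictly monotone lattice norm on
`ℝ²` with `p (1,0) = p (0,1) = 1`, and `Φ` is an Orlicz function with `a(Φ) = 0` satisfying
`Δ₂(ℝ₊)`, then `(L^Φ(μ), ‖·‖_{Φ,p})` is uniformly monotone. -/
theorem stmt14 {Ω : Type*} [MeasurableSpace Ω] (μ : Measure Ω) [SigmaFinite μ]
    (hna : NonAtomic μ) (hμ : μ Set.univ = ⊤)
    (Φ : ℝ → ℝ) (hΦ : IsOrlicz Φ) (ha : aPhi Φ = 0) (hΔ : Delta2 Φ)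
    (p : ℝ × ℝ → ℝ) (hp : IsLatticeNorm p) (hpm : StrictMonoNorm p)
    (h10 : p (1, 0) = 1) (h01 : p (0, 1) = 1) :
    ∀ ε : ℝ, ε ∈ Set.Ioo (0 : ℝ) 1 → ∃ δ ∈ Set.Ioo (0 : ℝ) 1,
      ∀ x y : Ω → ℝ, MemLphi μ Φ x → MemLphi μ Φ y →
        (∀ᵐ t ∂μ, 0 ≤ x t ∧ x t ≤ y t) → aNorm μ Φ p y = 1 →
        ENNReal.ofReal ε ≤ aNorm μ Φ p x →
        aNorm μ Φ p (fun t => y t - x t) ≤ ENNReal.ofReal (1 - δ) := by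
  rintro ε ⟨hε, -⟩
  obtain ⟨K, hK, hΔ⟩ := hΔ
  obtain ⟨n, hn⟩ := pow_unbounded_of_one_lt (4 / ε) (one_lt_two : (1 : ℝ) < 2)
  set c : ℝ := ε / 2 * 2 ^ n / K ^ n with hc_def
  have hc : 0 < c := by positivity
  obtain ⟨d, hd, hdec⟩ := hp.exists_uniform_decrease hpm h10 h01 hc
  obtain ⟨δ, hδ, hδd, hδ2⟩ : ∃ δ > 0, δ ≤ d / 2 ∧ δ ≤ 1 / 2 :=
    ⟨min (d / 2) (1 / 2), by positivity, min_le_left _ _, min_le_right _ _⟩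
  refine ⟨δ, ⟨hδ, by linarith⟩, fun x y _ _ hxy hy hx => ?_⟩
  obtain ⟨k, hk, hky⟩ : ∃ k : ℝ, 0 < k ∧ aTerm μ Φ p y k < ENNReal.ofReal (1 + δ) := by
    have : aNorm μ Φ p y < ENNReal.ofReal (1 + δ) := by
      rw [hy, ← ENNReal.ofReal_one, ENNReal.ofReal_lt_ofReal_iff (by linarith)]
      linarith
    simpa only [aNorm, iInf_lt_iff, exists_prop] using this
  have hyfin : Iphi μ Φ (fun t => k * y t) ≠ ⊤ := fun h => by simp [aTerm, h] at hky
  have hx0 : ∀ᵐ t ∂μ, 0 ≤ k * x t := hxy.mono fun t ht => mul_nonneg hk.le ht.1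
  have hz0 : ∀ᵐ t ∂μ, 0 ≤ k * (y t - x t) :=
    hxy.mono fun t ht => mul_nonneg hk.le (sub_nonneg.2 ht.2)
  have hsup := Iphi_add_le hΦ hx0 hz0
  simp only [← mul_add, add_sub_cancel] at hsup
  have hxfin : Iphi μ Φ (fun t => k * x t) ≠ ⊤ := ne_top_of_le_ne_top hyfin (le_self_add.trans hsup)
  have hzfin : Iphi μ Φ (fun t => k * (y t - x t)) ≠ ⊤ :=
    ne_top_of_le_ne_top hyfin (le_add_self.trans hsup)
  have hsup' := ENNReal.toReal_mono hyfin hsup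
  rw [ENNReal.toReal_add hxfin hzfin] at hsup'
  rw [aTerm, if_neg hyfin, ENNReal.ofReal_lt_ofReal_iff (by linarith)] at hky
  have hscale (s : ℝ) : 1 / k * p (1, s) = p (1 / k, s / k) := by
    have := hp.2.1 (1 / k) (1, s)
    rw [abs_of_pos (by positivity)] at this
    rw [← this, Prod.smul_mk, smul_eq_mul, smul_eq_mul, mul_one, one_div_mul_eq_div]
  set A := (Iphi μ Φ (fun t => k * y t)).toReal
  set B := (Iphi μ Φ (fun t => k * x t)).toReal with hB
  set C := (Iphi μ Φ (fun t => k * (y t - x t))).toReal with hC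
  have hA0 : 0 ≤ A := ENNReal.toReal_nonneg
  have hC0 : 0 ≤ C := ENNReal.toReal_nonneg
  rw [hscale] at hky
  have hk1 : 1 / k ≤ 1 + δ := by
    have h := hp.2.2.2 ((1 / k) • (1, 0)) (1 / k, A / k) (by simp) (by simp)
    rw [hp.2.1, h10, abs_of_pos (by positivity)] at h
    linarith
  have hA1 : A / k ≤ 1 + δ := by
    have h := hp.2.2.2 ((A / k) • (0, 1)) (1 / k, A / k) (by simp) (by simp)
    rw [hp.2.1, h01, abs_of_nonneg (by positivity)] at h
    linarith
  have hcB : c ≤ B / k := by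
    have hle := Iphi_two_pow_mul_le hK hΔ hx0 n
    simp only [← mul_assoc] at hle
    have htop : ENNReal.ofReal (K ^ n) * Iphi μ Φ (fun t => k * x t) ≠ ⊤ :=
      ENNReal.mul_ne_top ENNReal.ofReal_ne_top hxfin
    have h1 := le_of_ofReal_le_aNorm hp h10 h01 hε hx (by positivity)
      (ne_top_of_le_ne_top htop hle)
    have h2 := ENNReal.toReal_mono htop hle
    rw [ENNReal.toReal_mul, ENNReal.toReal_ofReal (by positivity), ← hB] at h2
    have hk2 : 1 ≤ 2 * k := by
      rw [div_le_iff₀ hk] at hk1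
      nlinarith
    rw [div_lt_iff₀ hε] at hn
    rw [hc_def, div_le_div_iff₀ (by positivity) hk]
    nlinarith
  have hcA : c + C / k ≤ A / k := by
    have := div_le_div_of_nonneg_right hsup' hk.le
    rw [add_div] at this
    linarith
  have hCk : 0 ≤ C / k := by positivity
  have hdec' := hdec (1 / k) (A / k) (by positivity) (by linarith) (by linarith) (by linarith)
  have hmono := hp.2.2.2 (1 / k, C / k) (1 / k, A / k - c) le_rfl
    (abs_le_abs_of_nonneg hCk (by simp only; linarith))
  refine (iInf₂_le k hk).trans ?_
  rw [aTerm, if_neg hzfin, ← hC, hscale]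
  exact ENNReal.ofReal_le_ofReal (by linarith)
end
end

section
/- Let μ be σ-finite, non-atomic with μ(Ω) = ∞, let p be a strictly monotone lattice norm on ℝ² with p((1,0)) = p((0,1)) = 1, and let Φ be an Orlicz function such that K(x) ≠ ∅ for every x ∈ E^Φ(μ) with x ≠ 0. If (E^Φ(μ), ‖·‖_{Φ,p}) is upper locally uniformly monotone, then a(Φ) = 0 and Φ satisfies condition Δ₂(ℝ₊). -/
open MeasureTheory Filter

noncomputable section

/-- In a non-atomic measure space, a set of positive finite measure has measurable subsets of
arbitrarily small positive measure. -/
lemma NonAtomic.exists_subset_measure_pos_lt {Ω : Type*} [MeasurableSpace Ω] {μ : Measure Ω}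
    (hna : NonAtomic μ) {T : Set Ω} (hT : MeasurableSet T) (hpos : 0 < μ T) (hfin : μ T ≠ ⊤)
    {c : ENNReal} (hc : c ≠ 0) : ∃ B ⊆ T, MeasurableSet B ∧ 0 < μ B ∧ μ B < c := by
  have halving : ∀ n : ℕ, ∃ B ⊆ T, MeasurableSet B ∧ 0 < μ B ∧ 2 ^ n * μ B ≤ μ T := by
    intro n
    induction n with
    | zero => exact ⟨T, subset_rfl, hT, hpos, by simp⟩
    | succ n ih =>
      obtain ⟨C, hCT, hC, hC0, hCle⟩ := ih
      obtain ⟨D, hDC, hD, hD0, hDlt⟩ := hna C hC hC0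
      have hCfin : μ C ≠ ⊤ := measure_ne_top_of_subset hCT hfin
      have hsum : μ D + μ (C \ D) = μ C := by
        have := measure_inter_add_sdiff (μ := μ) C hD
        rwa [Set.inter_eq_right.2 hDC] at this
      have hdiff : 0 < μ (C \ D) := by
        rw [pos_iff_ne_zero]
        intro h0
        rw [h0, add_zero] at hsum
        exact hDlt.ne hsum
      have step : ∀ E : Set Ω, 2 * μ E ≤ μ C → 2 ^ (n + 1) * μ E ≤ μ T := fun E hE =>
        calc 2 ^ (n + 1) * μ E = 2 ^ n * (2 * μ E) := by ring
          _ ≤ 2 ^ n * μ C := by gcongr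
          _ ≤ μ T := hCle
      rcases le_total (μ D) (μ (C \ D)) with h | h
      · refine ⟨D, hDC.trans hCT, hD, hD0, step D ?_⟩
        rw [two_mul, ← hsum]
        gcongr
      · refine ⟨C \ D, Set.sdiff_subset.trans hCT, hC.diff hD, hdiff, step _ ?_⟩
        rw [two_mul, ← hsum]
        gcongr
  obtain ⟨n, hn⟩ := ENNReal.exists_nat_mul_gt hc hfin
  obtain ⟨B, hBT, hB, hB0, hBle⟩ := halving n
  refine ⟨B, hBT, hB, hB0, ?_⟩
  by_contra! hcon
  have : (n : ENNReal) ≤ 2 ^ n := by exact_mod_cast Nat.lt_two_pow_self.le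
  exact absurd hn (not_lt.2 ((mul_le_mul' this hcon).trans hBle))

/-- In a non-atomic measure space, a measurable set of finite measure larger than `c` has a
measurable subset of measure between `c` and `2 * c`. -/
lemma NonAtomic.exists_subset_measure_between {Ω : Type*} [MeasurableSpace Ω] {μ : Measure Ω}
    (hna : NonAtomic μ) {T : Set Ω} (hT : MeasurableSet T) (hfin : μ T ≠ ⊤)
    {c : ENNReal} (hc : c ≠ 0) (hcT : c < μ T) :
    ∃ B ⊆ T, MeasurableSet B ∧ c ≤ μ B ∧ μ B ≤ 2 * c := by
  by_contra! hcon
  let F : Set (Set Ω) := {B | B ⊆ T ∧ MeasurableSet B ∧ μ B < c}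
  have of_le : ∀ B ⊆ T, MeasurableSet B → μ B ≤ 2 * c → B ∈ F := fun B hBT hB hle =>
    ⟨hBT, hB, by
      by_contra! h
      exact absurd hle (not_le.2 (hcon B hBT hB h))⟩
  have hunion : ∀ B ∈ F, ∀ C ∈ F, B ∪ C ∈ F := by
    rintro B ⟨hBT, hB, hBc⟩ C ⟨hCT, hC, hCc⟩
    refine of_le _ (Set.union_subset hBT hCT) (hB.union hC) ?_
    rw [two_mul]
    exact (measure_union_le B C).trans (add_le_add hBc.le hCc.le)
  have hempty : ∅ ∈ F := ⟨Set.empty_subset _, MeasurableSet.empty, by simpa using hc.bot_lt⟩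
  obtain ⟨u, -, hu, huF⟩ := exists_seq_tendsto_sSup (S := μ '' F) ⟨_, ∅, hempty, rfl⟩
    (OrderTop.bddAbove _)
  choose B hBF hBu using huF
  have hacc : ∀ n, Set.accumulate B n ∈ F := by
    intro n
    induction n with
    | zero => simpa using hBF 0
    | succ n ih =>
      rw [Set.accumulate_succ]
      exact hunion _ ih _ (hBF _)
  have hUc : μ (⋃ i, B i) ≤ c :=
    le_of_tendsto' tendsto_measure_iUnion_accumulate fun n => (hacc n).2.2.le
  have hUF : (⋃ i, B i) ∈ F := of_le _ (Set.iUnion_subset fun i => (hBF i).1)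
    (MeasurableSet.iUnion fun i => (hBF i).2.1) (hUc.trans (by rw [two_mul]; exact le_self_add))
  have hsup : sSup (μ '' F) ≤ μ (⋃ i, B i) :=
    le_of_tendsto' hu fun n => (hBu n).symm.le.trans (measure_mono (Set.subset_iUnion B n))
  have hUfin : μ (⋃ i, B i) ≠ ⊤ := measure_ne_top_of_subset hUF.1 hfin
  have hrest : 0 < μ (T \ ⋃ i, B i) := by
    rw [measure_sdiff hUF.1 hUF.2.1.nullMeasurableSet hUfin]
    exact tsub_pos_of_lt (hUF.2.2.trans hcT)
  obtain ⟨V, hVT, hV, hV0, hVc⟩ := hna.exists_subset_measure_pos_lt (hT.diff hUF.2.1) hrest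
    (measure_ne_top_of_subset Set.sdiff_subset hfin) hc
  have hUV := hunion _ hUF V ⟨hVT.trans Set.sdiff_subset, hV, hVc⟩
  have hle : μ ((⋃ i, B i) ∪ V) ≤ μ (⋃ i, B i) := (le_sSup (Set.mem_image_of_mem μ hUV)).trans hsup
  rw [measure_union (Set.disjoint_sdiff_right.mono_right hVT) hV] at hle
  exact absurd hle (not_le.2 (ENNReal.lt_add_right hUfin hV0.ne'))

lemma IsOrlicz.mul_le_mul {Φ : ℝ → ℝ} (hΦ : IsOrlicz Φ) {s m : ℝ} (hs : 0 < s) (hsm : s ≤ m)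
    (u : ℝ) : m * Φ (s * u) ≤ s * Φ (m * u) := by
  have hm : 0 < m := hs.trans_le hsm
  have h := hΦ.1.2 (Set.mem_univ (m * u)) (Set.mem_univ 0)
    (show 0 ≤ s / m by positivity)
    (show 0 ≤ 1 - s / m by rw [sub_nonneg, div_le_one hm]; exact hsm) (by ring)
  simp only [smul_eq_mul, mul_zero, add_zero, hΦ.2.2.1] at h
  have hsu : s / m * (m * u) = s * u := by field_simp
  rw [hsu] at h
  calc m * Φ (s * u) ≤ m * (s / m * Φ (m * u)) := by gcongr
    _ = s * Φ (m * u) := by field_simp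

lemma IsLatticeNorm.one_le {p : ℝ × ℝ → ℝ} (hp : IsLatticeNorm p) (h10 : p (1, 0) = 1) (t : ℝ) :
    1 ≤ p (1, t) :=
  h10.symm.le.trans (hp.2.2.2 _ _ le_rfl (by simp))

lemma IsLatticeNorm.zero_left {p : ℝ × ℝ → ℝ} (hp : IsLatticeNorm p) (h01 : p (0, 1) = 1)
    {t : ℝ} (ht : 0 ≤ t) : p (0, t) = t := by
  have := hp.2.1 t (0, 1)
  simpa [h01, abs_of_nonneg ht] using this

lemma IsLatticeNorm.le_snd {p : ℝ × ℝ → ℝ} (hp : IsLatticeNorm p) (h01 : p (0, 1) = 1)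
    {t : ℝ} (ht : 0 ≤ t) : t ≤ p (1, t) :=
  (hp.zero_left h01 ht).symm.le.trans (hp.2.2.2 _ _ (by simp) le_rfl)

lemma IsLatticeNorm.add_snd_le {p : ℝ × ℝ → ℝ} (hp : IsLatticeNorm p) (h01 : p (0, 1) = 1)
    (t : ℝ) {s : ℝ} (hs : 0 ≤ s) : p (1, t + s) ≤ p (1, t) + s := by
  have := hp.1 (1, t) (0, s)
  simpa [hp.zero_left h01 hs] using this

section Modular

variable {Ω : Type*} [MeasurableSpace Ω] {μ : Measure Ω} {Φ : ℝ → ℝ} {p : ℝ × ℝ → ℝ}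

lemma Iphi_indicator (h0 : Φ 0 = 0) {A : Set Ω} (hA : MeasurableSet A) (v k : ℝ) :
    Iphi μ Φ (fun t => k * A.indicator (fun _ => v) t) = ENNReal.ofReal (Φ (k * v)) * μ A := by
  rw [← lintegral_indicator_const hA, Iphi]
  congr 1
  ext t
  by_cases ht : t ∈ A <;> simp [ht, h0]

lemma Iphi_indicator_add (h0 : Φ 0 = 0) {A B : Set Ω} (hA : MeasurableSet A)
    (hB : MeasurableSet B) (hAB : Disjoint A B) (v w k : ℝ) :
    Iphi μ Φ (fun t => k * (A.indicator (fun _ => v) t + B.indicator (fun _ => w) t)) =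
      ENNReal.ofReal (Φ (k * v)) * μ A + ENNReal.ofReal (Φ (k * w)) * μ B := by
  rw [← lintegral_indicator_const hA, ← lintegral_indicator_const hB,
    ← lintegral_add_left (measurable_const.indicator hA), Iphi]
  congr 1
  ext t
  by_cases ht : t ∈ A
  · have htB : t ∉ B := Set.disjoint_left.1 hAB ht
    simp [ht, htB]
  · by_cases htB : t ∈ B <;> simp [ht, htB, h0]

lemma MemEphi_indicator (h0 : Φ 0 = 0) {A : Set Ω} (hA : MeasurableSet A) (hfin : μ A ≠ ⊤)
    (v : ℝ) : MemEphi μ Φ (A.indicator fun _ => v) := by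
  refine ⟨measurable_const.indicator hA, fun l _ => ?_⟩
  rw [Iphi_indicator h0 hA]
  exact ENNReal.mul_ne_top ENNReal.ofReal_ne_top hfin

lemma aNorm_le_aTerm (x : Ω → ℝ) {k : ℝ} (hk : 0 < k) : aNorm μ Φ p x ≤ aTerm μ Φ p x k :=
  iInf₂_le k hk

lemma aNorm_mul_le (x : Ω → ℝ) {c : ℝ} (hc : 0 < c) :
    aNorm μ Φ p (fun t => c * x t) ≤ ENNReal.ofReal c * aNorm μ Φ p x := by
  have hc0 : ENNReal.ofReal c ≠ 0 := by simpa using hc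
  unfold aNorm
  rw [ENNReal.mul_iInf_of_ne hc0 ENNReal.ofReal_ne_top]
  refine le_iInf fun k => ?_
  rw [ENNReal.mul_iInf_of_ne hc0 ENNReal.ofReal_ne_top]
  refine le_iInf fun hk => (iInf₂_le (k / c) (div_pos hk hc)).trans ?_
  have hfun : (fun t => k / c * (c * x t)) = fun t => k * x t := by
    ext t
    field_simp
  unfold aTerm
  rw [hfun]
  split_ifs with h
  · simp [ENNReal.mul_top hc0]
  · rw [← ENNReal.ofReal_mul hc.le]
    apply le_of_eq
    congr 1
    field_simp

lemma aNorm_mul (x : Ω → ℝ) {c : ℝ} (hc : 0 < c) :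
    aNorm μ Φ p (fun t => c * x t) = ENNReal.ofReal c * aNorm μ Φ p x := by
  refine le_antisymm (aNorm_mul_le x hc) ?_
  have h := aNorm_mul_le (μ := μ) (Φ := Φ) (p := p) (fun t => c * x t) (inv_pos.2 hc)
  simp only [inv_mul_cancel_left₀ hc.ne'] at h
  calc ENNReal.ofReal c * aNorm μ Φ p x
      ≤ ENNReal.ofReal c * (ENNReal.ofReal c⁻¹ * aNorm μ Φ p (fun t => c * x t)) := by gcongr
    _ = aNorm μ Φ p (fun t => c * x t) := by
      rw [← mul_assoc, ← ENNReal.ofReal_mul hc.le, mul_inv_cancel₀ hc.ne', ENNReal.ofReal_one,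
        one_mul]

lemma le_aNorm_indicator (hΦ : IsOrlicz Φ) (hp : IsLatticeNorm p) (h10 : p (1, 0) = 1)
    (h01 : p (0, 1) = 1) {A : Set Ω} (hA : MeasurableSet A) (hfin : μ A ≠ ⊤) (v : ℝ) {s : ℝ}
    (hs : 0 < s) :
    ENNReal.ofReal (min 1 (Φ (s * v) * (μ A).toReal) / s) ≤
      aNorm μ Φ p (A.indicator fun _ => v) := by
  refine le_iInf₂ fun m hm => ?_
  unfold aTerm
  rw [Iphi_indicator hΦ.2.2.1 hA,
    if_neg (ENNReal.mul_ne_top ENNReal.ofReal_ne_top hfin), ENNReal.toReal_mul,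
    ENNReal.toReal_ofReal (hΦ.2.2.2.1 _), one_div_mul_eq_div]
  apply ENNReal.ofReal_le_ofReal
  have hnn := hΦ.2.2.2.1
  have hμ : 0 ≤ (μ A).toReal := ENNReal.toReal_nonneg
  rw [div_le_div_iff₀ hs hm]
  rcases le_total m s with h | h
  · calc min 1 (Φ (s * v) * (μ A).toReal) * m ≤ 1 * s := by
          gcongr
          exact min_le_left _ _
      _ ≤ p (1, Φ (m * v) * (μ A).toReal) * s := by
          gcongr
          exact hp.one_le h10 _
  · calc min 1 (Φ (s * v) * (μ A).toReal) * m ≤ Φ (s * v) * (μ A).toReal * m := by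
          gcongr
          exact min_le_right _ _
      _ = m * Φ (s * v) * (μ A).toReal := by ring
      _ ≤ s * Φ (m * v) * (μ A).toReal := mul_le_mul_of_nonneg_right (hΦ.mul_le_mul hs h v) hμ
      _ = Φ (m * v) * (μ A).toReal * s := by ring
      _ ≤ p (1, Φ (m * v) * (μ A).toReal) * s := by
          gcongr
          exact hp.le_snd h01 (mul_nonneg (hnn _) hμ)

lemma exists_aNorm_indicator_eq_one (hΦ : IsOrlicz Φ) (hp : IsLatticeNorm p) (h10 : p (1, 0) = 1)
    (h01 : p (0, 1) = 1) {A : Set Ω} (hA : MeasurableSet A) (hpos : 0 < μ A) (hfin : μ A ≠ ⊤) :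
    ∃ v : ℝ, 0 < v ∧ aNorm μ Φ p (A.indicator fun _ => v) = 1 := by
  obtain ⟨w, hw0, hw⟩ : ∃ w : ℝ, 0 < w ∧ 0 < Φ w := by
    obtain ⟨u, hu⟩ := hΦ.2.2.2.2
    have hu0 : u ≠ 0 := fun h => hu (h ▸ hΦ.2.2.1)
    refine ⟨|u|, abs_pos.2 hu0, ?_⟩
    rcases abs_choice u with h | h
    · rw [h]
      exact lt_of_le_of_ne (hΦ.2.2.2.1 u) hu.symm
    · rw [h, hΦ.2.1]
      exact lt_of_le_of_ne (hΦ.2.2.2.1 u) hu.symm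
  have hlow := le_aNorm_indicator hΦ hp h10 h01 hA hfin w one_pos
  have hApos : 0 < (μ A).toReal := ENNReal.toReal_pos hpos.ne' hfin
  have hN0 : aNorm μ Φ p (A.indicator fun _ => w) ≠ 0 := by
    refine (lt_of_lt_of_le ?_ hlow).ne'
    rw [ENNReal.ofReal_pos, one_mul, div_one]
    exact lt_min one_pos (mul_pos hw hApos)
  have hNtop : aNorm μ Φ p (A.indicator fun _ => w) ≠ ⊤ := by
    refine ne_top_of_le_ne_top ?_ (aNorm_le_aTerm _ one_pos)
    unfold aTerm
    rw [if_neg ((MemEphi_indicator hΦ.2.2.1 hA hfin w).2 1 one_pos)]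
    exact ENNReal.ofReal_ne_top
  set r := (aNorm μ Φ p (A.indicator fun _ => w)).toReal with hr
  have hr0 : 0 < r := ENNReal.toReal_pos hN0 hNtop
  refine ⟨r⁻¹ * w, by positivity, ?_⟩
  have hfun : (A.indicator fun _ => r⁻¹ * w) = fun t => r⁻¹ * A.indicator (fun _ => w) t := by
    ext t
    by_cases ht : t ∈ A <;> simp [ht]
  rw [hfun, aNorm_mul _ (inv_pos.2 hr0), ← ENNReal.ofReal_toReal hNtop, ← hr,
    ← ENNReal.ofReal_mul (inv_pos.2 hr0).le, inv_mul_cancel₀ hr0.ne', ENNReal.ofReal_one]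

lemma IsOrlicz.aPhi_eq_zero_of_delta2 (hΦ : IsOrlicz Φ) (h : Delta2 Φ) : aPhi Φ = 0 := by
  obtain ⟨K, -, hK⟩ := h
  have hzero : ∀ u : ℝ, 0 ≤ u → Φ u = 0 → u = 0 := by
    intro u hu hu0
    by_contra hne
    have hupos : 0 < u := lt_of_le_of_ne hu (Ne.symm hne)
    have hpow : ∀ n : ℕ, Φ (2 ^ n * u) = 0 := by
      intro n
      induction n with
      | zero => simpa using hu0
      | succ n ih =>
        have := hK (2 ^ n * u) (by positivity)
        rw [ih, mul_zero, ← mul_assoc, ← pow_succ'] at this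
        exact le_antisymm this (hΦ.2.2.2.1 _)
    obtain ⟨w, hw⟩ := hΦ.2.2.2.2
    obtain ⟨n, hn⟩ := pow_unbounded_of_one_lt (|w| / u) one_lt_two
    have hw0 : 0 < |w| := abs_pos.2 fun h => hw (h ▸ hΦ.2.2.1)
    have hle := hΦ.mul_le_mul hw0 ((div_lt_iff₀ hupos).1 hn).le 1
    rw [mul_one, mul_one, hpow n, mul_zero] at hle
    have hΦw : Φ |w| = Φ w := by
      rcases abs_choice w with h | h
      · rw [h]
      · rw [h, hΦ.2.1]
    rw [hΦw] at hle
    have : 0 < Φ w := lt_of_le_of_ne (hΦ.2.2.2.1 w) hw.symm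
    have hpos : 0 < 2 ^ n * u * Φ w := by positivity
    exact absurd hle (not_le.2 hpos)
  have hset : {u : ℝ | 0 ≤ u ∧ Φ u = 0} = {0} := by
    ext u
    constructor
    · rintro ⟨h1, h2⟩
      exact hzero u h1 h2
    · rintro rfl
      exact ⟨le_rfl, hΦ.2.2.1⟩
  rw [aPhi, hset, csSup_singleton]

end Modular

/-- If `μ` is σ-finite, non-atomic and infinite, `p` is a strictly monotone lattice norm on
`ℝ²` with `p (1,0) = p (0,1) = 1`, `Φ` is an Orlicz function with `K(x) ≠ ∅` for every
nonzero `x ∈ E^Φ(μ)`, and `(E^Φ(μ), ‖·‖_{Φ,p})` is upper locally uniformly monotone, then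
`a(Φ) = 0` and `Φ` satisfies `Δ₂(ℝ₊)`. -/
theorem stmt15 {Ω : Type*} [MeasurableSpace Ω] (μ : Measure Ω) [SigmaFinite μ]
    (hna : NonAtomic μ) (hμ : μ Set.univ = ⊤)
    (Φ : ℝ → ℝ) (hΦ : IsOrlicz Φ)
    (p : ℝ × ℝ → ℝ) (hp : IsLatticeNorm p) (hpm : StrictMonoNorm p)
    (h10 : p (1, 0) = 1) (h01 : p (0, 1) = 1)
    (hK : ∀ x : Ω → ℝ, MemEphi μ Φ x → ¬ x =ᵐ[μ] 0 → (Kset μ Φ p x).Nonempty)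
    (hulum : ∀ y : Ω → ℝ, MemEphi μ Φ y → (∀ᵐ t ∂μ, 0 ≤ y t) → aNorm μ Φ p y = 1 →
      ∀ ε : ℝ, 0 < ε → ∃ σ : ℝ, 0 < σ ∧ ∀ x : Ω → ℝ, MemEphi μ Φ x →
        (∀ᵐ t ∂μ, 0 ≤ x t) → ENNReal.ofReal ε ≤ aNorm μ Φ p x →
        1 + ENNReal.ofReal σ ≤ aNorm μ Φ p (fun t => y t + x t)) :
    aPhi Φ = 0 ∧ Delta2 Φ := by
  suffices hD : Delta2 Φ from ⟨hΦ.aPhi_eq_zero_of_delta2 hD, hD⟩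
  have h0 := hΦ.2.2.1
  have hnn := hΦ.2.2.2.1
  obtain ⟨A, hA, -, hApos, hAfin⟩ :=
    Measure.exists_subset_measure_lt_top (μ := μ) (r := 0) MeasurableSet.univ (by simp [hμ])
  obtain ⟨v, hv, hy1⟩ := exists_aNorm_indicator_eq_one hΦ hp h10 h01 hA hApos hAfin.ne
  have hyE := MemEphi_indicator (μ := μ) h0 hA hAfin.ne v
  have hy0 : ¬ (A.indicator fun _ => v) =ᵐ[μ] 0 := by
    intro h
    have hsub : A ⊆ {t | ¬ A.indicator (fun _ => v) t = (0 : Ω → ℝ) t} := fun t ht => by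
      simp [ht, hv.ne']
    exact hApos.ne' (measure_mono_null hsub h)
  obtain ⟨k, hk, hky⟩ := hK _ hyE hy0
  obtain ⟨σ, hσ, hup⟩ := hulum _ hyE
    (Eventually.of_forall fun t => Set.indicator_nonneg (fun _ _ => hv.le) t) hy1
    (1 / (2 * k)) (by positivity)
  by_contra hD
  unfold Delta2 at hD
  push Not at hD
  obtain ⟨u, hu, hlt⟩ := hD (4 / (k * σ)) (by positivity)
  have h2u : 0 < Φ (2 * u) := lt_of_le_of_lt (mul_nonneg (by positivity) (hnn u)) hlt
  have hcompl : μ Aᶜ = ⊤ := by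
    have := measure_add_measure_compl (μ := μ) hA
    rw [hμ] at this
    exact (ENNReal.add_eq_top.1 this).resolve_left hAfin.ne
  obtain ⟨T, hT, hTA, hcT, hTfin⟩ := Measure.exists_subset_measure_lt_top (μ := μ)
    (r := ENNReal.ofReal (1 / Φ (2 * u))) hA.compl (by rw [hcompl]; exact ENNReal.ofReal_lt_top)
  obtain ⟨B, hBT, hB, hBlow, hBup⟩ := hna.exists_subset_measure_between hT hTfin.ne
    (by rw [Ne, ENNReal.ofReal_eq_zero, not_le]; positivity) hcT
  have hBfin : μ B ≠ ⊤ := measure_ne_top_of_subset hBT hTfin.ne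
  have hAB : Disjoint A B := disjoint_compl_right.mono_right (hBT.trans hTA)
  have hBlow' : 1 / Φ (2 * u) ≤ (μ B).toReal := (ENNReal.ofReal_le_iff_le_toReal hBfin).1 hBlow
  have hBup' : (μ B).toReal ≤ 2 * (1 / Φ (2 * u)) := by
    refine ENNReal.toReal_le_of_le_ofReal (by positivity) ?_
    rwa [ENNReal.ofReal_mul zero_le_two, ENNReal.ofReal_ofNat]
  have hux : 0 ≤ u / k := by positivity
  have hxnorm := le_aNorm_indicator hΦ hp h10 h01 hB hBfin (u / k) (s := 2 * k) (by positivity)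
  have h2k : 2 * k * (u / k) = 2 * u := by field_simp
  rw [h2k, min_eq_left (by rwa [div_le_iff₀' h2u] at hBlow')] at hxnorm
  have hcontra := (hup _ (MemEphi_indicator h0 hB hBfin (u / k))
    (Eventually.of_forall fun t => Set.indicator_nonneg (fun _ _ => hux) t) hxnorm).trans
    (aNorm_le_aTerm _ hk)
  have hku : k * (u / k) = u := by field_simp
  have hIA : ENNReal.ofReal (Φ (k * v)) * μ A ≠ ⊤ :=
    ENNReal.mul_ne_top ENNReal.ofReal_ne_top hAfin.ne
  have hIB : ENNReal.ofReal (Φ u) * μ B ≠ ⊤ := ENNReal.mul_ne_top ENNReal.ofReal_ne_top hBfin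
  have hterm : 1 / k * p (1, (ENNReal.ofReal (Φ (k * v)) * μ A).toReal) = 1 := by
    rw [hy1, aTerm, Iphi_indicator h0 hA, if_neg hIA] at hky
    exact ENNReal.ofReal_eq_one.1 hky.symm
  rw [aTerm, Iphi_indicator_add h0 hA hB hAB, hku, if_neg (ENNReal.add_ne_top.2 ⟨hIA, hIB⟩),
    ENNReal.toReal_add hIA hIB, ← ENNReal.ofReal_one, ← ENNReal.ofReal_add zero_le_one hσ.le,
    ENNReal.ofReal_le_ofReal_iff'] at hcontra
  have hcontra := hcontra.resolve_right (by linarith)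
  have hadd := hp.add_snd_le h01 (ENNReal.ofReal (Φ (k * v)) * μ A).toReal
    (s := (ENNReal.ofReal (Φ u) * μ B).toReal) ENNReal.toReal_nonneg
  have hsmall : 1 / k * (ENNReal.ofReal (Φ u) * μ B).toReal ≤ σ / 2 := by
    rw [ENNReal.toReal_mul, ENNReal.toReal_ofReal (hnn u)]
    have hratio : Φ u / Φ (2 * u) ≤ k * σ / 4 := by
      rw [div_le_iff₀ h2u]
      rw [div_mul_eq_mul_div, div_lt_iff₀ (by positivity)] at hlt
      linarith
    calc 1 / k * (Φ u * (μ B).toReal) ≤ 1 / k * (Φ u * (2 * (1 / Φ (2 * u)))) := by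
          have := hnn u
          gcongr
      _ = 2 / k * (Φ u / Φ (2 * u)) := by ring
      _ ≤ 2 / k * (k * σ / 4) := by gcongr
      _ = σ / 2 := by field_simp; norm_num
  have hmul := mul_le_mul_of_nonneg_left hadd (one_div_pos.2 hk).le
  rw [mul_add, hterm] at hmul
  linarith
end
end
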